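/- For every non-negative integer n and every real number y, n! · C(y, n+1) = Σ_{k=0}^n s(n,k) · (B_{k+1}(y) - B_{k+1})/(k+1), where C(y, n+1) = y(y-1)⋯(y-n)/(n+1)! is the generalized binomial coefficient, s(n,k) are the (signed) Stirling numbers of the first kind, B_{k+1}(y) are the Bernoulli polynomials, and B_{k+1} = B_{k+1}(0) are the Bernoulli numbers. -/

import Mathlib

theorem sum_range_descPochhammer_eval (n m : ℕ) :
    ∑ j ∈ Finset.range m, (descPochhammer ℝ n).eval (j : ℝ) =
      (descPochhammer ℝ (n + 1)).eval (m : ℝ) / (n + 1) := by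
  have hn : (n + 1 : ℝ) ≠ 0 := by positivity
  induction m with
  | zero => simp [descPochhammer_ne_zero_eval_zero]
  | succ m ih =>
    have hleft : (descPochhammer ℝ (n + 1)).eval ((m : ℝ) + 1) =
        (m + 1) * (descPochhammer ℝ n).eval (m : ℝ) := by
      simp [descPochhammer_succ_left]
    rw [Finset.sum_range_succ, ih, Nat.cast_succ, hleft, descPochhammer_succ_eval]
    field_simp
    ring

theorem sum_range_pow_eq_aeval_bernoulli_sub (k m : ℕ) :
    ∑ j ∈ Finset.range m, (j : ℝ) ^ k =
      (Polynomial.aeval (m : ℝ) (Polynomial.bernoulli (k + 1)) -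
        ((bernoulli (k + 1) : ℚ) : ℝ)) / (k + 1) := by
  have hk : (k + 1 : ℝ) ≠ 0 := by positivity
  have h := congrArg (fun q : ℚ => (q : ℝ)) (Polynomial.sum_range_pow_eq_bernoulli_sub m k)
  have haeval : Polynomial.aeval (m : ℝ) (Polynomial.bernoulli (k + 1)) =
      (((Polynomial.bernoulli (k + 1)).eval (m : ℚ) : ℚ) : ℝ) := by
    simpa using Polynomial.aeval_algebraMap_apply_eq_algebraMap_eval (A := ℝ) (m : ℚ)
      (Polynomial.bernoulli (k + 1))
  rw [haeval, eq_div_iff hk, mul_comm]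
  push_cast at h
  exact h


/-- For every non-negative integer `n` and real `y`,
`n! · C(y, n+1) = ∑_{k=0}^n s(n,k) · (B_{k+1}(y) - B_{k+1})/(k+1)`,
where `C(y, n+1) = y(y-1)⋯(y-n)/(n+1)!` is the generalized binomial
coefficient, `s(n,k)` is the signed Stirling number of the first kind,
`B_{k+1}(y)` is the Bernoulli polynomial and `B_{k+1} = B_{k+1}(0)` is the
Bernoulli number. -/
theorem factorial_binomial_succ_eq_stirling_bernoulli_sum (n : ℕ) (y : ℝ) :
    (Nat.factorial n : ℝ) *
        ((descPochhammer ℝ (n + 1)).eval y / Nat.factorial (n + 1)) =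
      ∑ k ∈ Finset.range (n + 1),
        (descPochhammer ℝ n).coeff k *
          (Polynomial.aeval y (Polynomial.bernoulli (k + 1)) -
            ((bernoulli (k + 1) : ℚ) : ℝ)) / (k + 1) := by
  let P : Polynomial ℝ := Polynomial.C ((n : ℝ) + 1)⁻¹ * descPochhammer ℝ (n + 1)
  let Q : Polynomial ℝ := ∑ k ∈ Finset.range (n + 1),
    Polynomial.C ((descPochhammer ℝ n).coeff k / (k + 1)) *
      ((Polynomial.bernoulli (k + 1)).map (algebraMap ℚ ℝ) -
        Polynomial.C ((bernoulli (k + 1) : ℚ) : ℝ))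
  have hP (x : ℝ) : P.eval x = (descPochhammer ℝ (n + 1)).eval x / (n + 1) := by
    simp [P, div_eq_inv_mul]
  have hQ (x : ℝ) : Q.eval x = ∑ k ∈ Finset.range (n + 1),
      (descPochhammer ℝ n).coeff k *
        (Polynomial.aeval x (Polynomial.bernoulli (k + 1)) -
          ((bernoulli (k + 1) : ℚ) : ℝ)) / (k + 1) := by
    simp only [Q, Polynomial.eval_finsetSum, Polynomial.eval_mul, Polynomial.eval_sub,
      Polynomial.eval_C, Polynomial.eval_map_algebraMap, div_mul_eq_mul_div]
  have hnat (m : ℕ) : P.eval (m : ℝ) = Q.eval (m : ℝ) := by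
    rw [hP, hQ, ← sum_range_descPochhammer_eval]
    simp only [mul_div_assoc, ← sum_range_pow_eq_aeval_bernoulli_sub, Finset.mul_sum]
    rw [Finset.sum_comm]
    refine Finset.sum_congr rfl fun j _ => ?_
    rw [Polynomial.eval_eq_sum_range, descPochhammer_natDegree]
  have hPQ : P = Q := Polynomial.eq_of_infinite_eval_eq P Q <|
    (Set.infinite_range_of_injective (Nat.cast_injective (R := ℝ))).mono <| by
      rintro _ ⟨m, rfl⟩
      exact hnat m
  rw [← hQ, ← hPQ, hP, Nat.factorial_succ]
  have hfac : (n.factorial : ℝ) ≠ 0 := by positivity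
  push_cast
  field_simp
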